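/- For every integer q ≥ 1 and every integer r with 0 ≤ r ≤ 2^q − 1, writing j = 2^q + r and d = 2^{q+1} + r − 1, the ideal A_j of R is contained in the ideal B_d of R. (Consequently, for these critical values of j and d the ℤ-coefficient ideal-valued bound of the paper's main theorem gives no admissible triples beyond those obtained from the subgroup (ℤ/2)².) -/

import Mathlib

open MvPolynomial

noncomputable section

/-- The relations `2Y, 2M, 4W, M² − W·Y` in `ℤ[Y,M,W]` (with `Y = X 0`, `M = X 1`, `W = X 2`). -/
def relIdeal : Ideal (MvPolynomial (Fin 3) ℤ) :=
  Ideal.span {2 * X 0, 2 * X 1, 4 * X 2, X 1 ^ 2 - X 2 * X 0}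

/-- The ring `R = ℤ[Y,M,W]/⟨2Y, 2M, 4W, M² − W·Y⟩`. -/
abbrev Rring : Type := MvPolynomial (Fin 3) ℤ ⧸ relIdeal

/-- The image of `Y` in `R`. -/
def Yv : Rring := Ideal.Quotient.mk relIdeal (X 0)

/-- The image of `M` in `R`. -/
def Mv : Rring := Ideal.Quotient.mk relIdeal (X 1)

/-- The image of `W` in `R`. -/
def Wv : Rring := Ideal.Quotient.mk relIdeal (X 2)

/-- `Π_d = Σ_{0 ≤ 2i ≤ d−1} (C(d−1−i, i) mod 2)·W^i·Y^{d−2i} ∈ R`,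
the binomial coefficients being taken mod 2 as elements 0 or 1 of ℤ. -/
def PiR (d : ℕ) : Rring :=
  ∑ i ∈ Finset.range (d + 1),
    if 2 * i + 1 ≤ d then
      ((((d - 1 - i).choose i % 2 : ℕ) : Rring)) * Wv ^ i * Yv ^ (d - 2 * i)
    else 0

/-- The ideal `A_j ⊆ R`. -/
def AIdeal (j : ℕ) : Ideal Rring :=
  if j % 2 = 0 then Ideal.span {Yv ^ (j / 2) * Wv ^ (j / 2)}
  else
    Ideal.span {Yv ^ ((j + 1) / 2) * Wv ^ ((j - 1) / 2) * Mv,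
      Yv ^ ((j + 1) / 2) * Wv ^ ((j + 1) / 2)}

/-- The ideal `B_d ⊆ R`. -/
def BIdeal (d : ℕ) : Ideal Rring :=
  if d % 2 = 0 then
    Ideal.span {PiR ((d + 2) / 2), PiR ((d + 4) / 2), Mv * PiR (d / 2)}
  else Ideal.span {PiR ((d + 1) / 2), PiR ((d + 3) / 2)}

section FibPoly

variable {S : Type*} [CommRing S]

/-- The bivariate Fibonacci sequence: `F₀ = 0`, `F₁ = 1`, `F_{n+2} = y F_{n+1} + w F_n`. -/
def fibPoly (y w : S) : ℕ → S
  | 0 => 0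
  | 1 => 1
  | n + 2 => y * fibPoly y w (n + 1) + w * fibPoly y w n

theorem fibPoly_add_two (y w : S) (n : ℕ) :
    fibPoly y w (n + 2) = y * fibPoly y w (n + 1) + w * fibPoly y w n := rfl

theorem fibPoly_add_add_one (y w : S) (m n : ℕ) :
    fibPoly y w (m + n + 1) =
      fibPoly y w (m + 1) * fibPoly y w (n + 1) + w * (fibPoly y w m * fibPoly y w n) := by
  induction m generalizing n with
  | zero => simp [fibPoly]
  | succ m ih =>
    rw [show m + 1 + n + 1 = m + (n + 1) + 1 by ring, ih (n + 1), fibPoly_add_two,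
      fibPoly_add_two]
    ring

theorem choose_succ_succ_mul_pow (y w : S) (a b : ℕ) :
    ((a + 1).choose (b + 1) : S) * w ^ (b + 1) * y ^ (a + 1 - (b + 1)) =
      w * ((a.choose b : S) * w ^ b * y ^ (a - b)) +
        y * ((a.choose (b + 1) : S) * w ^ (b + 1) * y ^ (a - (b + 1))) := by
  rw [Nat.choose_succ_succ, Nat.add_sub_add_right]
  rcases Nat.lt_or_ge a (b + 1) with h | h
  · simp only [Nat.choose_eq_zero_of_lt h]
    push_cast
    ring
  · obtain ⟨c, rfl⟩ := Nat.exists_eq_add_of_le h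
    rw [show b + 1 + c - b = c + 1 by omega, show b + 1 + c - (b + 1) = c by omega]
    push_cast
    ring

theorem fibPoly_succ_eq_sum_antidiagonal (y w : S) (n : ℕ) :
    fibPoly y w (n + 1) =
      ∑ p ∈ Finset.HasAntidiagonal.antidiagonal n, (p.1.choose p.2 : S) * w ^ p.2 * y ^ (p.1 - p.2) := by
  induction n using Nat.twoStepInduction with
  | zero => simp [fibPoly]
  | one => simp [fibPoly, Finset.Nat.antidiagonal_succ]
  | more n h₁ h₂ =>
    rw [fibPoly_add_two, h₁, h₂, Finset.Nat.antidiagonal_succ_succ', Finset.Nat.antidiagonal_succ']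
    have h := Finset.sum_congr (rfl : Finset.HasAntidiagonal.antidiagonal n = _) fun p _ =>
      choose_succ_succ_mul_pow y w p.1 p.2
    simp only [Finset.sum_add_distrib, ← Finset.mul_sum, Nat.add_sub_add_right] at h
    simp [h]
    ring

theorem mul_fibPoly_two_mul {y : S} (w : S) (hy : 2 * y = 0) (n : ℕ) :
    y * fibPoly y w (2 * n) = (y * fibPoly y w n) ^ 2 := by
  cases n with
  | zero => simp [fibPoly]
  | succ n =>
    rw [show 2 * (n + 1) = (n + 1) + n + 1 by ring, fibPoly_add_add_one, fibPoly_add_two]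
    linear_combination (w * fibPoly y w (n + 1) * fibPoly y w n) * hy

theorem mul_fibPoly_two_pow {y : S} (w : S) (hy : 2 * y = 0) (q : ℕ) :
    y * fibPoly y w (2 ^ q) = y ^ 2 ^ q := by
  induction q with
  | zero => simp [fibPoly]
  | succ q ih => rw [pow_succ', mul_fibPoly_two_mul w hy, ih, ← pow_mul, mul_comm]

theorem exists_mul_fibPoly_two_pow_add_one {y : S} (w : S) (hy : 2 * y = 0) (q : ℕ) :
    ∃ c, y * fibPoly y w (2 ^ (q + 1) + 1) = y * (w ^ 2 ^ q + y ^ 2 ^ q * c) := by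
  induction q with
  | zero => exact ⟨y, by simp [fibPoly]; ring⟩
  | succ q ih =>
    obtain ⟨c, hc⟩ := ih
    have hF := mul_fibPoly_two_pow w hy (q + 1)
    obtain ⟨k, hk⟩ : ∃ k, 2 ^ q = k + 1 := Nat.exists_eq_succ_of_ne_zero (by positivity)
    refine ⟨c ^ 2 + w * y ^ (2 * k), ?_⟩
    rw [show 2 ^ (q + 1 + 1) + 1 = 2 ^ (q + 1) + 2 ^ (q + 1) + 1 by ring, fibPoly_add_add_one]
    have h2 : 2 ^ (q + 1) = 2 * k + 2 := by rw [pow_succ, hk]; ring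
    rw [h2] at hF hc ⊢
    rw [hk] at hc
    generalize fibPoly y w (2 * k + 2) = a at *
    generalize fibPoly y w (2 * k + 2 + 1) = b at *
    linear_combination (b + (w ^ (k + 1) + y ^ (k + 1) * c)) * hc +
      (w * a + w * y ^ (2 * k + 1)) * hF + w ^ (k + 1) * y ^ (k + 1) * c * hy

end FibPoly

theorem two_mul_Yv : 2 * Yv = 0 := by
  have : Ideal.Quotient.mk relIdeal (2 * X 0) = 0 :=
    Ideal.Quotient.eq_zero_iff_mem.mpr (Ideal.subset_span (by simp))
  rwa [map_mul, map_ofNat] at this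

theorem natCast_mod_two_mul_Yv (n : ℕ) : ((n % 2 : ℕ) : Rring) * Yv = n * Yv := by
  conv_rhs => rw [← Nat.mod_add_div n 2]
  push_cast
  linear_combination -((n / 2 : ℕ) : Rring) * two_mul_Yv

theorem PiR_eq (n : ℕ) : PiR n = Yv * fibPoly Yv Wv n := by
  cases n with
  | zero => simp [PiR, fibPoly]
  | succ n =>
    rw [fibPoly_succ_eq_sum_antidiagonal, Finset.Nat.sum_antidiagonal_eq_sum_range_succ_mk,
      ← Finset.sum_flip, PiR, Finset.sum_range_succ, if_neg (by omega), add_zero, Finset.mul_sum]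
    refine Finset.sum_congr rfl fun i hi => ?_
    have hi' : i ≤ n := Nat.lt_succ_iff.mp (Finset.mem_range.mp hi)
    rw [Nat.sub_sub_self hi', Nat.add_sub_cancel]
    split_ifs with h
    · rw [show n + 1 - 2 * i = n - i - i + 1 by omega]
      linear_combination (Wv ^ i * Yv ^ (n - i - i)) *
        natCast_mod_two_mul_Yv ((n - i).choose i)
    · simp [Nat.choose_eq_zero_of_lt (show n - i < i by omega)]

theorem PiR_add_two (n : ℕ) : PiR (n + 2) = Yv * PiR (n + 1) + Wv * PiR n := by
  simp only [PiR_eq, fibPoly_add_two]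
  ring

theorem Wv_mul_mem_span_PiR {n : ℕ} {x : Rring}
    (hx : x ∈ Ideal.span {PiR n, PiR (n + 1)}) :
    Wv * x ∈ Ideal.span {PiR (n + 1), PiR (n + 2)} := by
  obtain ⟨a, b, rfl⟩ := Ideal.mem_span_pair.mp hx
  refine Ideal.mem_span_pair.mpr ⟨Wv * b - a * Yv, a, ?_⟩
  rw [PiR_add_two]
  ring

theorem Yv_mul_Wv_pow_mem_span_PiR (q s : ℕ) :
    (Yv * Wv) ^ (2 ^ q + s) ∈
      Ideal.span {PiR (2 ^ (q + 1) + s), PiR (2 ^ (q + 1) + s + 1)} := by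
  induction s with
  | zero =>
    obtain ⟨c, hc⟩ := exists_mul_fibPoly_two_pow_add_one Wv two_mul_Yv q
    obtain ⟨k, hk⟩ : ∃ k, 2 ^ q = k + 1 := Nat.exists_eq_succ_of_ne_zero (by positivity)
    refine Ideal.mem_span_pair.mpr ⟨-c, Yv ^ k, ?_⟩
    rw [add_zero, add_zero, PiR_eq, PiR_eq, mul_fibPoly_two_pow _ two_mul_Yv, hc, pow_succ, hk]
    ring
  | succ s ih =>
    have h := Ideal.mul_mem_left _ Yv (Wv_mul_mem_span_PiR ih)
    rwa [show Yv * (Wv * (Yv * Wv) ^ (2 ^ q + s)) = (Yv * Wv) ^ (2 ^ q + (s + 1)) by ring] at h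

/-- For every `q ≥ 1` and every `r` with `0 ≤ r ≤ 2^q − 1`, writing
`j = 2^q + r` and `d = 2^{q+1} + r − 1`, the ideal `A_j` is contained in `B_d`. -/
theorem statement11 (q r : ℕ) (hq : 1 ≤ q) (hr : r ≤ 2 ^ q - 1) :
    AIdeal (2 ^ q + r) ≤ BIdeal (2 ^ (q + 1) + r - 1) := by
  obtain ⟨q, rfl⟩ := Nat.exists_eq_add_of_le' hq
  have hpow : 2 ^ (q + 1) = 2 * 2 ^ q := pow_succ' 2 q
  have hpow' : 2 ^ (q + 1 + 1) = 4 * 2 ^ q := by ring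
  have hpos : 0 < 2 ^ q := by positivity
  obtain ⟨s, rfl | rfl⟩ := Nat.even_or_odd' r
  · rw [AIdeal, BIdeal, if_pos (by omega), if_neg (by omega), Ideal.span_singleton_le_iff_mem,
      ← mul_pow, show (2 ^ (q + 1) + 2 * s) / 2 = 2 ^ q + s by omega,
      show (2 ^ (q + 1 + 1) + 2 * s - 1 + 1) / 2 = 2 ^ (q + 1) + s by omega,
      show (2 ^ (q + 1 + 1) + 2 * s - 1 + 3) / 2 = 2 ^ (q + 1) + s + 1 by omega]
    exact Yv_mul_Wv_pow_mem_span_PiR q s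
  · rw [AIdeal, BIdeal, if_neg (by omega), if_pos (by omega),
      show (2 ^ (q + 1) + (2 * s + 1) + 1) / 2 = 2 ^ q + s + 1 by omega,
      show (2 ^ (q + 1) + (2 * s + 1) - 1) / 2 = 2 ^ q + s by omega,
      show (2 ^ (q + 1 + 1) + (2 * s + 1) - 1 + 2) / 2 = 2 ^ (q + 1) + s + 1 by omega,
      show (2 ^ (q + 1 + 1) + (2 * s + 1) - 1 + 4) / 2 = 2 ^ (q + 1) + s + 2 by omega,
      show (2 ^ (q + 1 + 1) + (2 * s + 1) - 1) / 2 = 2 ^ (q + 1) + s by omega,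
      Ideal.span_le, Set.pair_subset_iff]
    constructor
    · obtain ⟨a, b, hab⟩ := Ideal.mem_span_pair.mp (Yv_mul_Wv_pow_mem_span_PiR q s)
      refine Ideal.mem_span_insert.mpr ⟨Yv * Mv * b, _,
        Ideal.mul_mem_left _ (Yv * a) (Ideal.subset_span (Set.mem_insert_of_mem _ rfl)), ?_⟩
      rw [mul_pow] at hab
      rw [pow_succ]
      linear_combination -(Yv * Mv) * hab
    · rw [← mul_pow]
      exact Ideal.span_mono (by simp [Set.pair_subset_iff, ← add_assoc])
        (Yv_mul_Wv_pow_mem_span_PiR q (s + 1))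

end
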